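/- arXiv:2212.13626 — 5 statements merged into one kernel-verified Lean document; each statement's English description precedes it below -/
import Mathlib

section
/- Let N ≥ 2, let C > 0, let K be a real N×N matrix, and let F(α) = Σ_{i=1}^N Σ_{j=1}^N α_i α_j K_{ij} − Σ_{i=1}^N α_i K_{ii} be the SVDD dual objective. Suppose α* ∈ Δ(N,C) is a global minimizer of F over Δ(N,C) and α*_t = 0 for some index t. Then the vector α' ∈ ℝ^{N−1} obtained from α* by deleting coordinate t lies in Δ(N−1,C) and is a global minimizer over Δ(N−1,C) of the objective F'(β) = Σ_{i≠t} Σ_{j≠t} β_i β_j K_{ij} − Σ_{i≠t} β_i K_{ii} associated with the submatrix of K obtained by deleting row and column t. -/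
/-- The feasible set Δ of the dual SVM problems over a finite index type:
`0 ≤ α i ≤ C` for all `i`, and `∑ i, α i = 1`. -/
def Delta {ι : Type*} [Fintype ι] (C : ℝ) : Set (ι → ℝ) :=
  {α | (∀ i, 0 ≤ α i ∧ α i ≤ C) ∧ ∑ i, α i = 1}

theorem sum_subtype_ne_of_eq_zero {ι M : Type*} [Fintype ι] [DecidableEq ι] [AddCommMonoid M]
    {t : ι} {f : ι → M} (hf : f t = 0) : ∑ i : {i : ι // i ≠ t}, f i.1 = ∑ i, f i := by
  rw [Fintype.sum_eq_add_sum_subtype_ne f t, hf, zero_add]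

/-- Deleting a coordinate where `γ` vanishes leaves the SVDD dual objective unchanged. -/
theorem svdd_objective_subtype_ne {ι : Type*} [Fintype ι] [DecidableEq ι] (K : ι → ι → ℝ)
    {t : ι} {γ : ι → ℝ} (hγ : γ t = 0) :
    (∑ i : {i : ι // i ≠ t}, ∑ j : {i : ι // i ≠ t}, γ i.1 * γ j.1 * K i.1 j.1) -
        ∑ i : {i : ι // i ≠ t}, γ i.1 * K i.1 i.1 =
      (∑ i, ∑ j, γ i * γ j * K i j) - ∑ i, γ i * K i i := by
  have hinner (i : ι) :
      ∑ j : {i : ι // i ≠ t}, γ i * γ j.1 * K i j.1 = ∑ j, γ i * γ j * K i j :=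
    sum_subtype_ne_of_eq_zero (f := fun j => γ i * γ j * K i j) (by simp [hγ])
  simp only [hinner]
  rw [sum_subtype_ne_of_eq_zero (f := fun i => ∑ j, γ i * γ j * K i j) (by simp [hγ]),
    sum_subtype_ne_of_eq_zero (f := fun i => γ i * K i i) (by simp [hγ])]

/-- **Theorem 1 (SVDD version).** If `α*` is a global minimizer of the SVDD dual
objective `F(α) = ∑ᵢ∑ⱼ αᵢαⱼKᵢⱼ − ∑ᵢ αᵢKᵢᵢ` over `Δ(N,C)` and `α*_t = 0`, then the
vector obtained by deleting coordinate `t` is feasible for the leave-one-out problem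
(over the indices `≠ t`, a set of size `N−1`) and globally minimizes the
corresponding objective for the submatrix of `K` with row and column `t` deleted. -/
theorem losdd_leave_out_svdd (N : ℕ) (hN : 2 ≤ N) (C : ℝ) (hC : 0 < C)
    (K : Fin N → Fin N → ℝ) (α : Fin N → ℝ)
    (hα : α ∈ Delta C)
    (hmin : ∀ β ∈ Delta C,
      (∑ i, ∑ j, α i * α j * K i j) - ∑ i, α i * K i i ≤
      (∑ i, ∑ j, β i * β j * K i j) - ∑ i, β i * K i i)
    (t : Fin N) (ht : α t = 0) :
    (fun i : {i : Fin N // i ≠ t} => α i.1) ∈ Delta C ∧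
    ∀ β : {i : Fin N // i ≠ t} → ℝ, β ∈ Delta C →
      (∑ i : {i : Fin N // i ≠ t}, ∑ j : {i : Fin N // i ≠ t},
          α i.1 * α j.1 * K i.1 j.1) - ∑ i : {i : Fin N // i ≠ t}, α i.1 * K i.1 i.1 ≤
      (∑ i : {i : Fin N // i ≠ t}, ∑ j : {i : Fin N // i ≠ t},
          β i * β j * K i.1 j.1) - ∑ i : {i : Fin N // i ≠ t}, β i * K i.1 i.1 := by
  refine ⟨⟨fun i => hα.1 i.1, (sum_subtype_ne_of_eq_zero ht).trans hα.2⟩, fun β hβ => ?_⟩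
  obtain ⟨γ, hγt, rfl⟩ : ∃ γ : Fin N → ℝ, γ t = 0 ∧ (fun i : {i // i ≠ t} => γ i.1) = β :=
    ⟨fun i => if h : i ≠ t then β ⟨i, h⟩ else 0, by simp, by
      ext i
      simp [i.2]⟩
  rw [svdd_objective_subtype_ne K ht, svdd_objective_subtype_ne K hγt]
  refine hmin γ ⟨fun i => ?_, (sum_subtype_ne_of_eq_zero hγt).symm.trans hβ.2⟩
  by_cases hi : i = t
  · subst hi
    simp [hγt, hC.le]
  · exact hβ.1 ⟨i, hi⟩
end

section
/- Let N ≥ 2, let C > 0, let K be a real N×N matrix, and let F(α) = (1/2) Σ_{i=1}^N Σ_{j=1}^N α_i α_j K_{ij} be the one-class SVM (OCSVM) dual objective. Suppose α* ∈ Δ(N,C) is a global minimizer of F over Δ(N,C) and α*_t = 0 for some index t. Then the vector α' ∈ ℝ^{N−1} obtained from α* by deleting coordinate t lies in Δ(N−1,C) and is a global minimizer over Δ(N−1,C) of the objective F'(β) = (1/2) Σ_{i≠t} Σ_{j≠t} β_i β_j K_{ij} associated with the submatrix of K obtained by deleting row and column t. -/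
/-- Deleting an index where `f` vanishes does not change the sum of `f`. -/
theorem sum_subtype_ne_eq_sum {ι M : Type*} [Fintype ι] [DecidableEq ι] [AddCommMonoid M]
    (t : ι) (f : ι → M) (hf : f t = 0) :
    ∑ i : {i : ι // i ≠ t}, f i.1 = ∑ i, f i := by
  rw [← Finset.sum_subtype (Finset.univ.erase t) (by simp) f]
  exact Finset.sum_erase _ hf

/-- Deleting an index where `a` vanishes does not change the quadratic form of `K` at `a`. -/
theorem sum_sum_subtype_ne_eq_sum_sum {ι R : Type*} [Fintype ι] [DecidableEq ι]
    [NonUnitalNonAssocSemiring R] (K : ι → ι → R) (a : ι → R) (t : ι) (ha : a t = 0) :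
    ∑ i : {i : ι // i ≠ t}, ∑ j : {i : ι // i ≠ t}, a i.1 * a j.1 * K i.1 j.1 =
      ∑ i, ∑ j, a i * a j * K i j := by
  rw [← sum_subtype_ne_eq_sum t (fun i => ∑ j, a i * a j * K i j) (by simp [ha])]
  exact Finset.sum_congr rfl fun i _ =>
    sum_subtype_ne_eq_sum t (fun j => a i.1 * a j * K i.1 j) (by simp [ha])

/-- Deleting a vanishing coordinate does not affect feasibility. -/
theorem restrict_ne_mem_Delta_iff {ι : Type*} [Fintype ι] [DecidableEq ι] {C : ℝ} (hC : 0 ≤ C)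
    (a : ι → ℝ) (t : ι) (ha : a t = 0) :
    (fun i : {i : ι // i ≠ t} => a i.1) ∈ Delta C ↔ a ∈ Delta C := by
  simp only [Delta, Set.mem_ofPred_eq]
  rw [sum_subtype_ne_eq_sum t a ha]
  refine and_congr_left fun _ => ⟨fun h i => ?_, fun h i => h i.1⟩
  by_cases hi : i = t
  · subst hi
    simp [ha, hC]
  · exact h ⟨i, hi⟩

/-- **Theorem 1 (OCSVM version).** If `α*` is a global minimizer of the OCSVM dual
objective `F(α) = (1/2)∑ᵢ∑ⱼ αᵢαⱼKᵢⱼ` over `Δ(N,C)` and `α*_t = 0`, then the vector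
obtained by deleting coordinate `t` is feasible for the leave-one-out problem (over
the indices `≠ t`, a set of size `N−1`) and globally minimizes the corresponding
objective for the submatrix of `K` with row and column `t` deleted. -/
theorem losdd_leave_out_ocsvm (N : ℕ) (hN : 2 ≤ N) (C : ℝ) (hC : 0 < C)
    (K : Fin N → Fin N → ℝ) (α : Fin N → ℝ)
    (hα : α ∈ Delta C)
    (hmin : ∀ β ∈ Delta C,
      (1/2 : ℝ) * ∑ i, ∑ j, α i * α j * K i j ≤
      (1/2 : ℝ) * ∑ i, ∑ j, β i * β j * K i j)
    (t : Fin N) (ht : α t = 0) :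
    (fun i : {i : Fin N // i ≠ t} => α i.1) ∈ Delta C ∧
    ∀ β : {i : Fin N // i ≠ t} → ℝ, β ∈ Delta C →
      (1/2 : ℝ) * ∑ i : {i : Fin N // i ≠ t}, ∑ j : {i : Fin N // i ≠ t},
          α i.1 * α j.1 * K i.1 j.1 ≤
      (1/2 : ℝ) * ∑ i : {i : Fin N // i ≠ t}, ∑ j : {i : Fin N // i ≠ t},
          β i * β j * K i.1 j.1 := by
  refine ⟨(restrict_ne_mem_Delta_iff hC.le α t ht).2 hα, fun β hβ => ?_⟩
  obtain ⟨b, hbt, rfl⟩ : ∃ b : Fin N → ℝ, b t = 0 ∧ (fun i : {i : Fin N // i ≠ t} => b i.1) = β :=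
    ⟨fun i => if h : i ≠ t then β ⟨i, h⟩ else 0, by simp, funext fun i => by simp [i.2]⟩
  rw [sum_sum_subtype_ne_eq_sum_sum K α t ht, sum_sum_subtype_ne_eq_sum_sum K b t hbt]
  exact hmin b ((restrict_ne_mem_Delta_iff hC.le b t hbt).1 hβ)
end

section
/- Let K be a real symmetric positive semidefinite N×N matrix, d ∈ ℝ^N, C > 0, let F(α) = αᵀKα − dᵀα with gradient G = ∇F(α) = 2Kα − d, and let α ∈ Δ(N,C). Then α is a global minimizer of F over Δ(N,C) if and only if for every pair of indices i, k with α_i < C and α_k > 0 one has G_i ≥ G_k (equivalently, min over {i : α_i < C} of G_i is at least max over {k : α_k > 0} of G_k). -/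
/-- Second-order expansion of the quadratic objective `αᵀKα − dᵀα` for symmetric `K`. -/
lemma quadratic_objective_add {ι : Type*} [Fintype ι] {K : Matrix ι ι ℝ}
    (hK : ∀ i j, K i j = K j i) (d α v : ι → ℝ) :
    (∑ i, ∑ j, (α i + v i) * (α j + v j) * K i j) - ∑ i, d i * (α i + v i) =
      ((∑ i, ∑ j, α i * α j * K i j) - ∑ i, d i * α i) +
        ∑ i, (2 * (∑ j, K i j * α j) - d i) * v i + ∑ i, ∑ j, v i * v j * K i j := by
  have hswap : ∑ i, ∑ j, α i * v j * K i j = ∑ i, ∑ j, v i * α j * K i j := by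
    rw [Finset.sum_comm]
    refine Finset.sum_congr rfl fun i _ => Finset.sum_congr rfl fun j _ => ?_
    rw [hK j i]
    ring
  have hlin : ∑ i, (2 * (∑ j, K i j * α j) - d i) * v i =
      2 * (∑ i, ∑ j, v i * α j * K i j) - ∑ i, d i * v i := by
    rw [Finset.mul_sum, ← Finset.sum_sub_distrib]
    refine Finset.sum_congr rfl fun i _ => ?_
    have : ∑ j, v i * α j * K i j = v i * ∑ j, K i j * α j := by
      rw [Finset.mul_sum]
      exact Finset.sum_congr rfl fun j _ => by ring
    rw [this]
    ring
  have hquad : ∑ i, ∑ j, (α i + v i) * (α j + v j) * K i j =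
      (∑ i, ∑ j, α i * α j * K i j) + (∑ i, ∑ j, α i * v j * K i j) +
        (∑ i, ∑ j, v i * α j * K i j) + ∑ i, ∑ j, v i * v j * K i j := by
    simp only [← Finset.sum_add_distrib]
    exact Finset.sum_congr rfl fun i _ => Finset.sum_congr rfl fun j _ => by ring
  rw [hquad, hlin, hswap]
  simp only [mul_add, Finset.sum_add_distrib]
  ring

lemma Matrix.PosSemidef.sum_sum_mul_nonneg {ι : Type*} [Fintype ι] {K : Matrix ι ι ℝ}
    (hK : K.PosSemidef) (v : ι → ℝ) : 0 ≤ ∑ i, ∑ j, v i * v j * K i j := by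
  have h := hK.dotProduct_mulVec_nonneg v
  simp only [dotProduct, Matrix.mulVec, Pi.star_apply, star_trivial, Finset.mul_sum] at h
  refine h.trans_eq (Finset.sum_congr rfl fun i _ => Finset.sum_congr rfl fun j _ => ?_)
  ring

/-- Moving mass `t` from coordinate `k` to coordinate `i` stays in the feasible set. -/
lemma add_smul_single_sub_single_mem_Delta {ι : Type*} [Fintype ι] [DecidableEq ι] {C : ℝ}
    {α : ι → ℝ} (hα : α ∈ Delta C) {i k : ι} (hik : i ≠ k) {t : ℝ} (ht : 0 ≤ t)
    (hi : t ≤ C - α i) (hk : t ≤ α k) :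
    (fun j => α j + t * (Pi.single i 1 - Pi.single k 1 : ι → ℝ) j) ∈ Delta C := by
  refine ⟨fun j => ?_, ?_⟩
  · have hj := hα.1 j
    rcases eq_or_ne j i with rfl | hji
    · simp only [Pi.sub_apply, Pi.single_eq_same, Pi.single_eq_of_ne hik]
      constructor <;> linarith
    rcases eq_or_ne j k with rfl | hjk
    · simp only [Pi.sub_apply, Pi.single_eq_same, Pi.single_eq_of_ne hji]
      constructor <;> linarith
    · simpa [Pi.single_eq_of_ne hji, Pi.single_eq_of_ne hjk] using hj
  · simp [Finset.sum_add_distrib, ← Finset.mul_sum, hα.2]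

/-- The first-order optimality condition over the feasible set follows from the absence of a
violating pair. -/
lemma sum_mul_sub_nonneg_of_no_violating_pair {ι : Type*} [Fintype ι] {C : ℝ}
    {α β G : ι → ℝ} (hα : α ∈ Delta C) (hβ : β ∈ Delta C)
    (h : ∀ i k, α i < C → 0 < α k → G k ≤ G i) : 0 ≤ ∑ i, G i * (β i - α i) := by
  classical
  obtain ⟨k₀, -, hk₀⟩ : ∃ k ∈ Finset.univ, 0 < α k := by
    apply Finset.exists_lt_of_sum_lt
    simp [hα.2]
  obtain ⟨m, hm, hmax⟩ := Finset.exists_max_image (Finset.univ.filter fun k => 0 < α k) G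
    ⟨k₀, by simpa using hk₀⟩
  have hm' : 0 < α m := by simpa using hm
  have hshift : ∑ i, G i * (β i - α i) = ∑ i, (G i - G m) * (β i - α i) := by
    simp only [sub_mul _ (G m), Finset.sum_sub_distrib, ← Finset.mul_sum, hα.2, hβ.2]
    ring
  rw [hshift]
  refine Finset.sum_nonneg fun i _ => ?_
  rcases lt_trichotomy (β i) (α i) with hlt | heq | hgt
  · have hi : G i ≤ G m := hmax i (by simpa using (hβ.1 i).1.trans_lt hlt)
    exact mul_nonneg_of_nonpos_of_nonpos (by linarith) (by linarith)
  · simp [heq]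
  · have hi : G m ≤ G i := h i m (hgt.trans_le (hβ.1 i).2) hm'
    exact mul_nonneg (by linarith) (by linarith)

/-- **Most-violating-pair criterion.** For the quadratic objective
`F(α) = αᵀKα − dᵀα` with `K` symmetric positive semidefinite and gradient
`G = 2Kα − d`, a feasible `α ∈ Δ(N,C)` is a global minimizer over `Δ(N,C)` iff
`G i ≥ G k` whenever `α i < C` and `α k > 0`. -/
theorem most_violating_pair_criterion (N : ℕ) (K : Matrix (Fin N) (Fin N) ℝ)
    (hK : K.PosSemidef) (d : Fin N → ℝ) (C : ℝ) (hC : 0 < C)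
    (α : Fin N → ℝ) (hα : α ∈ Delta C)
    (G : Fin N → ℝ) (hG : G = fun i => 2 * (∑ j, K i j * α j) - d i) :
    (∀ β ∈ Delta C,
        (∑ i, ∑ j, α i * α j * K i j) - ∑ i, d i * α i ≤
        (∑ i, ∑ j, β i * β j * K i j) - ∑ i, d i * β i) ↔
    (∀ i k : Fin N, α i < C → 0 < α k → G k ≤ G i) := by
  have hsymm : ∀ i j, K i j = K j i := fun i j => by simpa using hK.isHermitian.apply j i
  have hexp : ∀ v : Fin N → ℝ,
      (∑ i, ∑ j, (α i + v i) * (α j + v j) * K i j) - ∑ i, d i * (α i + v i) =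
        ((∑ i, ∑ j, α i * α j * K i j) - ∑ i, d i * α i) +
          ∑ i, G i * v i + ∑ i, ∑ j, v i * v j * K i j := by
    intro v
    rw [hG]
    exact quadratic_objective_add hsymm d α v
  constructor
  · intro hmin i k hi hk
    by_contra! hlt
    have hik : i ≠ k := by
      rintro rfl
      exact lt_irrefl _ hlt
    set u : Fin N → ℝ := Pi.single i 1 - Pi.single k 1 with hu
    set q := ∑ i, ∑ j, u i * u j * K i j with hq
    have hq0 : 0 ≤ q := hK.sum_sum_mul_nonneg u
    have key : ∀ t, 0 < t → t ≤ C - α i → t ≤ α k → 0 ≤ (G i - G k) + t * q := by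
      intro t ht hti htk
      have hle := hmin _ (add_smul_single_sub_single_mem_Delta hα hik ht.le hti htk)
      have hlin : ∑ j, G j * (t * u j) = t * (G i - G k) := by
        simp [hu, mul_sub, Finset.sum_sub_distrib, Pi.single_apply, mul_comm]
      have hquad : ∑ i, ∑ j, (t * u i) * (t * u j) * K i j = t * (t * q) := by
        simp only [hq, Finset.mul_sum]
        exact Finset.sum_congr rfl fun i _ => Finset.sum_congr rfl fun j _ => by ring
      have he := hexp fun j => t * u j
      rw [hlin, hquad] at he
      have : 0 ≤ t * ((G i - G k) + t * q) := by
        rw [mul_add]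
        linarith
      exact nonneg_of_mul_nonneg_right this ht
    set s := (G k - G i) / (q + 1) with hs
    have hs0 : 0 < s := div_pos (by linarith) (by linarith)
    have hsq : s * (q + 1) = G k - G i := div_mul_cancel₀ _ (by linarith)
    have ht0 : 0 < min s (min (C - α i) (α k)) := lt_min hs0 (lt_min (by linarith) hk)
    have hkey := key _ ht0 ((min_le_right _ _).trans (min_le_left _ _))
      ((min_le_right _ _).trans (min_le_right _ _))
    have := mul_le_mul_of_nonneg_right (min_le_left s (min (C - α i) (α k))) hq0
    linarith
  · intro h β hβ
    have he := hexp fun j => β j - α j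
    simp only [add_sub_cancel] at he
    have hlin := sum_mul_sub_nonneg_of_no_violating_pair hα hβ h
    have hquad := hK.sum_sum_mul_nonneg fun j => β j - α j
    linarith
end

section
/- Let K be a real symmetric positive semidefinite N×N matrix, C > 0, and let α ∈ Δ(N,C) be a global minimizer over Δ(N,C) of the OCSVM dual objective F(α) = (1/2) αᵀKα. Then for any two indices i, j with 0 < α_i < C and 0 < α_j < C, one has (Kα)_i = (Kα)_j, i.e., Σ_m α_m K_{mi} = Σ_m α_m K_{mj}. -/
/-- Second-order expansion of the quadratic form of a symmetric matrix along a line. -/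
lemma sum_sum_add_mul_quadratic {ι : Type*} [Fintype ι] (K : Matrix ι ι ℝ)
    (hK : ∀ a b, K a b = K b a) (x d : ι → ℝ) (t : ℝ) :
    ∑ a, ∑ b, (x a + t * d a) * (x b + t * d b) * K a b =
      ∑ a, ∑ b, x a * x b * K a b + t * (2 * ∑ b, d b * ∑ a, x a * K a b) +
        t ^ 2 * ∑ a, ∑ b, d a * d b * K a b := by
  have hcross : ∑ a, ∑ b, d a * x b * K a b = ∑ b, d b * ∑ a, x a * K a b := by
    simp only [Finset.mul_sum]
    refine Finset.sum_congr rfl fun a _ => Finset.sum_congr rfl fun b _ => ?_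
    rw [hK a b]; ring
  have hcross' : ∑ a, ∑ b, x a * d b * K a b = ∑ b, d b * ∑ a, x a * K a b := by
    rw [Finset.sum_comm]
    simp only [Finset.mul_sum]
    refine Finset.sum_congr rfl fun a _ => Finset.sum_congr rfl fun b _ => ?_
    ring
  rw [two_mul]
  nth_rewrite 1 [← hcross]
  rw [← hcross']
  simp only [Finset.mul_sum, mul_add, ← Finset.sum_add_distrib]
  refine Finset.sum_congr rfl fun a _ => Finset.sum_congr rfl fun b _ => ?_
  ring

/-- Moving mass between two free coordinates stays in `Delta C` for small steps. -/
lemma eventually_add_single_sub_single_mem_Delta {ι : Type*} [Fintype ι] [DecidableEq ι]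
    {C : ℝ} {x : ι → ℝ} (hx : x ∈ Delta C) {i j : ι} (hi : x i ∈ Set.Ioo 0 C)
    (hj : x j ∈ Set.Ioo 0 C) :
    ∀ᶠ t : ℝ in nhds 0,
      (fun a => x a + t * (Pi.single i 1 - Pi.single j 1 : ι → ℝ) a) ∈ Delta C := by
  have key : ∀ a, ∀ᶠ t : ℝ in nhds 0,
      x a + t * (Pi.single i 1 - Pi.single j 1 : ι → ℝ) a ∈ Set.Icc 0 C := by
    intro a
    by_cases ha : x a ∈ Set.Ioo 0 C
    · have hcont : ContinuousAt
          (fun t : ℝ => x a + t * (Pi.single i 1 - Pi.single j 1 : ι → ℝ) a) 0 := by fun_prop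
      exact hcont.eventually (Icc_mem_nhds (by simpa using ha.1) (by simpa using ha.2))
    · have hai : a ≠ i := by rintro rfl; exact ha hi
      have haj : a ≠ j := by rintro rfl; exact ha hj
      simpa [hai, haj] using hx.1 a
  filter_upwards [Filter.eventually_all.2 key] with t ht
  refine ⟨ht, ?_⟩
  rw [Finset.sum_add_distrib, hx.2, ← Finset.mul_sum]
  simp

/-- **Well-definedness of the OCSVM bias.** If `α` globally minimizes the OCSVM
dual objective `F(α) = (1/2)αᵀKα` over `Δ(N,C)` and `i`, `j` are free support
vectors (`0 < α_i < C`, `0 < α_j < C`), then `(Kα)_i = (Kα)_j`. -/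
theorem ocsvm_bias_well_defined (N : ℕ) (K : Matrix (Fin N) (Fin N) ℝ)
    (hK : K.PosSemidef) (C : ℝ) (hC : 0 < C)
    (α : Fin N → ℝ) (hα : α ∈ Delta C)
    (hmin : ∀ β ∈ Delta C,
        (1/2 : ℝ) * ∑ i, ∑ j, α i * α j * K i j ≤
        (1/2 : ℝ) * ∑ i, ∑ j, β i * β j * K i j)
    (i j : Fin N) (hi0 : 0 < α i) (hiC : α i < C) (hj0 : 0 < α j) (hjC : α j < C) :
    ∑ m, α m * K m i = ∑ m, α m * K m j := by
  have hsymm : ∀ a b, K a b = K b a := fun a b => by simpa using hK.isHermitian.apply b a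
  set d : Fin N → ℝ := Pi.single i 1 - Pi.single j 1 with hd
  set D := ∑ b, d b * ∑ a, α a * K a b with hD
  set q := ∑ a, ∑ b, d a * d b * K a b
  have hloc : IsLocalMin (fun t : ℝ => t * (2 * D) + t ^ 2 * q) 0 := by
    filter_upwards [eventually_add_single_sub_single_mem_Delta hα ⟨hi0, hiC⟩ ⟨hj0, hjC⟩]
      with t ht
    have h := hmin _ ht
    rw [sum_sum_add_mul_quadratic K hsymm] at h
    simp only [← hd, ← hD] at h
    norm_num
    linarith
  have hderiv : HasDerivAt (fun t : ℝ => t * (2 * D) + t ^ 2 * q) (2 * D) 0 := by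
    refine (((hasDerivAt_id (0 : ℝ)).mul_const (2 * D)).add
      ((hasDerivAt_pow 2 (0 : ℝ)).mul_const q)).congr_deriv ?_
    simp
  have hzero := hloc.hasDerivAt_eq_zero hderiv
  have hDval : D = ∑ m, α m * K m i - ∑ m, α m * K m j := by
    simp [hD, hd, sub_mul, Finset.sum_sub_distrib, Pi.single_apply]
  linarith
end

section
/- Let E be a real inner product space, let x_1, …, x_N ∈ E, let C > 0, and let α ∈ Δ(N,C). Suppose (R, a, ξ) with R ∈ ℝ, a ∈ E, ξ ∈ ℝ^N is primal feasible for SVDD, i.e., ξ_i ≥ 0 and ‖x_i − a‖² ≤ R² + ξ_i for all i. Then Σ_{i=1}^N α_i ‖x_i‖² − ‖Σ_{i=1}^N α_i x_i‖² ≤ R² + C Σ_{i=1}^N ξ_i. -/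
/-- For weights summing to one, the weighted variance of a family of points is its weighted second
moment about any point `a`, minus the squared distance from `a` to the weighted mean. -/
theorem sum_mul_norm_sq_sub_norm_sum_sq {ι E : Type*} [Fintype ι] [NormedAddCommGroup E]
    [InnerProductSpace ℝ E] (α : ι → ℝ) (x : ι → E) (a : E) (hα : ∑ i, α i = 1) :
    (∑ i, α i * ‖x i‖ ^ 2) - ‖∑ i, α i • x i‖ ^ 2 =
      (∑ i, α i * ‖x i - a‖ ^ 2) - ‖∑ i, α i • x i - a‖ ^ 2 := by
  have hmoment : ∑ i, α i * ‖x i - a‖ ^ 2 =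
      (∑ i, α i * ‖x i‖ ^ 2) - 2 * inner ℝ (∑ i, α i • x i) a + ‖a‖ ^ 2 := by
    have hinner : inner ℝ (∑ i, α i • x i) a = ∑ i, α i * inner ℝ (x i) a := by
      simp only [sum_inner, real_inner_smul_left]
    have hnorm : ‖a‖ ^ 2 = ∑ i, α i * ‖a‖ ^ 2 := by rw [← Finset.sum_mul, hα, one_mul]
    rw [hinner, hnorm, Finset.mul_sum, ← Finset.sum_sub_distrib, ← Finset.sum_add_distrib]
    refine Finset.sum_congr rfl fun i _ => ?_
    rw [norm_sub_sq_real]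
    ring
  rw [hmoment, norm_sub_sq_real (∑ i, α i • x i) a]
  ring

/-- **Weak duality for SVDD (linear kernel).** If `α ∈ Δ(N,C)` and `(R,a,ξ)` is
primal feasible (`ξᵢ ≥ 0` and `‖xᵢ − a‖² ≤ R² + ξᵢ` for all `i`), then the dual
objective value `∑ᵢ αᵢ‖xᵢ‖² − ‖∑ᵢ αᵢxᵢ‖²` is at most the primal objective value
`R² + C∑ᵢξᵢ`. -/
theorem svdd_weak_duality {E : Type*} [NormedAddCommGroup E]
    [InnerProductSpace ℝ E] (N : ℕ) (x : Fin N → E) (C : ℝ) (hC : 0 < C)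
    (α : Fin N → ℝ) (hα : α ∈ Delta C)
    (R : ℝ) (a : E) (ξ : Fin N → ℝ)
    (hξ : ∀ i, 0 ≤ ξ i) (hfeas : ∀ i, ‖x i - a‖ ^ 2 ≤ R ^ 2 + ξ i) :
    (∑ i, α i * ‖x i‖ ^ 2) - ‖∑ i, α i • x i‖ ^ 2 ≤ R ^ 2 + C * ∑ i, ξ i := by
  obtain ⟨hbox, hsum⟩ := hα
  rw [sum_mul_norm_sq_sub_norm_sum_sq α x a hsum]
  have hbound : ∑ i, α i * ‖x i - a‖ ^ 2 ≤ R ^ 2 + C * ∑ i, ξ i := by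
    calc ∑ i, α i * ‖x i - a‖ ^ 2
        ≤ ∑ i, (α i * R ^ 2 + C * ξ i) := Finset.sum_le_sum fun i _ => by
          nlinarith [mul_le_mul_of_nonneg_left (hfeas i) (hbox i).1,
            mul_le_mul_of_nonneg_right (hbox i).2 (hξ i)]
      _ = R ^ 2 + C * ∑ i, ξ i := by
          rw [Finset.sum_add_distrib, ← Finset.sum_mul, hsum, one_mul, Finset.mul_sum]
  linarith [sq_nonneg ‖∑ i, α i • x i - a‖]
end
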